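/- arXiv:1509.06660 — 2 statements merged into one kernel-verified Lean document; each statement's English description precedes it below -/
import Mathlib

section
/- Let H ≤ G be abelian groups and K a divisible abelian group such that r_p(H) < r_p(K) and r_p(G) ≤ r_p(K) for all p ∈ {0} ∪ ℙ (free rank for p = 0 and p-ranks for primes p). Then every injective homomorphism j : H → K extends to an injective homomorphism j' : G → K. -/
/-- The `p`-rank of an abelian group: the `𝔽_p`-dimension of the `p`-socle `G[p]`. -/
noncomputable def pRank (p : ℕ) (G : Type) [AddCommGroup G] : Cardinal :=
  letI := AddSubgroup.torsionBy.zmodModule (A := G) (n := p)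
  Module.rank (ZMod p) (AddSubgroup.torsionBy G p)

/-- Over a domain, passing to quotients by submodules of equal rank, less than the rank of the
target, preserves inequality of ranks. -/
theorem rank_quotient_le_rank_quotient {R : Type} [CommRing R] [IsDomain R]
    {M N : Type} [AddCommGroup M] [Module R M] [AddCommGroup N] [Module R N]
    (U : Submodule R M) (V : Submodule R N) (hUV : Module.rank R U = Module.rank R V)
    (hV : Module.rank R V < Module.rank R N) (hMN : Module.rank R M ≤ Module.rank R N) :
    Module.rank R (M ⧸ U) ≤ Module.rank R (N ⧸ V) := by
  have hM := U.rank_quotient_add_rank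
  have hN := V.rank_quotient_add_rank
  rcases lt_or_ge (Module.rank R N) Cardinal.aleph0 with hfin | hinf
  · rw [← Cardinal.add_le_add_iff_of_lt_aleph0 (hV.trans hfin), hN, ← hUV, hM]
    exact hMN
  · rw [add_comm] at hN
    rw [Cardinal.eq_of_add_eq_of_aleph0_le hN hV hinf]
    exact (rank_quotient_le U).trans hMN

theorem LinearMap.coprod_linearCombination_injective {R : Type} [CommRing R]
    {L N ι : Type} [AddCommGroup L] [Module R L] [AddCommGroup N] [Module R N]
    {j : L →ₗ[R] N} (hj : Function.Injective j) {c : ι → N}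
    (hc : LinearIndependent R ((LinearMap.range j).mkQ ∘ c)) :
    Function.Injective (j.coprod (Finsupp.linearCombination R c)) := by
  rw [injective_iff_map_eq_zero]
  rintro ⟨u, a⟩ h
  rw [LinearMap.coprod_apply] at h
  have ha : a = 0 := by
    rw [linearIndependent_iff] at hc
    apply hc
    rw [← Finsupp.apply_linearCombination]
    have := congrArg (LinearMap.range j).mkQ h
    have hju : (LinearMap.range j).mkQ (j u) = 0 := by simp
    rwa [map_add, hju, zero_add, map_zero] at this
  subst ha
  rw [map_zero, add_zero] at h
  rw [(injective_iff_map_eq_zero j).1 hj u h]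
  rfl

/-- An injective homomorphism from a submodule into an injective module extends to a homomorphism
with torsion kernel, if the ranks permit it. -/
theorem Module.Baer.exists_extension_torsion_ker {R : Type} [CommRing R] [IsDomain R]
    {M N : Type} [AddCommGroup M] [Module R M] [AddCommGroup N] [Module R N]
    (hN : Module.Baer R N) (U : Submodule R M) (j : U →ₗ[R] N) (hj : Function.Injective j)
    (hU : Module.rank R U < Module.rank R N) (hMN : Module.rank R M ≤ Module.rank R N) :
    ∃ f : M →ₗ[R] N, (∀ u : U, f u = j u) ∧ ∀ x, f x = 0 → ∃ a : R, a ≠ 0 ∧ a • x = 0 := by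
  have hrank : Module.rank R U = Module.rank R (LinearMap.range j) :=
    (LinearEquiv.ofInjective j hj).rank_eq
  have hle := rank_quotient_le_rank_quotient U (LinearMap.range j) hrank (hrank ▸ hU) hMN
  obtain ⟨s, hs, hmax⟩ := exists_maximal_linearIndepOn R (id : M ⧸ U → M ⧸ U)
  obtain ⟨t, ht, hti⟩ := exists_set_linearIndependent R (N ⧸ LinearMap.range j)
  have hs' : LinearIndependent R (fun x : s => (x : M ⧸ U)) := hs
  obtain ⟨φ⟩ : Nonempty (s ↪ t) := by
    rw [← Cardinal.le_def, ht]
    exact hs'.cardinal_le_rank.trans hle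
  let e : s → M := fun i => Function.surjInv U.mkQ_surjective i
  have he (i : s) : U.mkQ (e i) = i := Function.surjInv_eq U.mkQ_surjective _
  let c : s → N := fun i => Function.surjInv (LinearMap.range j).mkQ_surjective (φ i)
  have hc (i : s) : (LinearMap.range j).mkQ (c i) = φ i :=
    Function.surjInv_eq (LinearMap.range j).mkQ_surjective _
  have hα : Function.Injective (U.subtype.coprod (Finsupp.linearCombination R e)) := by
    apply LinearMap.coprod_linearCombination_injective U.subtype_injective
    rw [U.range_subtype, show U.mkQ ∘ e = fun x : s => (x : M ⧸ U) from funext he]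
    exact hs'
  have hβ : Function.Injective (j.coprod (Finsupp.linearCombination R c)) := by
    apply LinearMap.coprod_linearCombination_injective hj
    rw [show (LinearMap.range j).mkQ ∘ c = Subtype.val ∘ φ from funext hc]
    exact hti.comp φ φ.injective
  obtain ⟨f, hf⟩ := hN.extension_property _ hα (j.coprod (Finsupp.linearCombination R c))
  have hf' (d) := LinearMap.congr_fun hf d
  refine ⟨f, fun u => by simpa using hf' (u, 0), fun x hx => ?_⟩
  obtain ⟨a, ha, hax⟩ : ∃ a : R, a ≠ 0 ∧ a • U.mkQ x ∈ Submodule.span R s := by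
    by_cases hxs : U.mkQ x ∈ s
    · exact ⟨1, one_ne_zero, by simpa using Submodule.subset_span hxs⟩
    · simpa using hmax _ hxs
  refine ⟨a, ha, ?_⟩
  obtain ⟨b, hb⟩ : ∃ b : s →₀ R, Finsupp.linearCombination R (fun x : s => (x : M ⧸ U)) b =
      a • U.mkQ x := by
    rw [← LinearMap.mem_range, Finsupp.range_linearCombination, Subtype.range_coe]
    exact hax
  have hmem : a • x - Finsupp.linearCombination R e b ∈ U := by
    rw [← Submodule.Quotient.mk_eq_zero, ← Submodule.mkQ_apply, map_sub, map_smul, ← hb, Finsupp.apply_linearCombination,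
      show U.mkQ ∘ e = fun x : s => (x : M ⧸ U) from funext he, sub_self]
  have key := hf' (⟨_, hmem⟩, b)
  have hd : U.subtype.coprod (Finsupp.linearCombination R e) (⟨_, hmem⟩, b) = a • x := by simp
  rw [LinearMap.comp_apply, hd, map_smul, hx, smul_zero] at key
  rw [← hd, (injective_iff_map_eq_zero _).1 hβ _ key.symm, map_zero]

/-- Homomorphisms into an injective module extend along any map whose kernel they kill, even a
non-injective one. -/
theorem Module.Baer.exists_comp_eq {R : Type} [CommRing R] {D M N : Type} [AddCommGroup D]
    [Module R D] [AddCommGroup M] [Module R M] [AddCommGroup N] [Module R N]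
    (hN : Module.Baer R N) (α : D →ₗ[R] M) (β : D →ₗ[R] N)
    (h : LinearMap.ker α ≤ LinearMap.ker β) : ∃ f : M →ₗ[R] N, ∀ d, f (α d) = β d := by
  obtain ⟨f, hf⟩ := hN.extension_property ((LinearMap.ker α).liftQ α le_rfl)
    (LinearMap.ker_eq_bot.1 (Submodule.ker_liftQ_eq_bot _ _ _ le_rfl))
    ((LinearMap.ker α).liftQ β h)
  exact ⟨f, fun d => by simpa using LinearMap.congr_fun hf (Submodule.Quotient.mk d)⟩

/-- The components of an element of a subgroup in the `p`-socles belong to the subgroup. -/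
theorem AddSubgroup.mem_of_sum_mem_of_prime_smul_eq_zero {G : Type} [AddCommGroup G]
    (H : AddSubgroup G) (s : Finset Nat.Primes) (x : Nat.Primes → G)
    (hx : ∀ p ∈ s, (p : ℕ) • x p = 0) (hsum : ∑ p ∈ s, x p ∈ H) (q : Nat.Primes) (hq : q ∈ s) :
    x q ∈ H := by
  classical
  set N : ℕ := ∏ p ∈ s.erase q, (p : ℕ) with hN
  have hNx (p) (hp : p ∈ s.erase q) : N • x p = 0 := by
    obtain ⟨k, hk⟩ := Finset.dvd_prod_of_mem (fun p : Nat.Primes => (p : ℕ)) hp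
    rw [hN, hk, mul_comm, mul_smul, hx p (Finset.mem_of_mem_erase hp), smul_zero]
  have hNq : N • x q ∈ H := by
    have := H.nsmul_mem hsum N
    rwa [Finset.smul_sum, ← Finset.add_sum_erase s _ hq, Finset.sum_eq_zero hNx, add_zero] at this
  have hco : Nat.Coprime N q := by
    refine Nat.Coprime.prod_left fun p hp => ?_
    exact (Nat.coprime_primes p.2 q.2).2 fun h => Finset.ne_of_mem_erase hp (Subtype.ext h)
  have hbez := Nat.gcd_eq_gcd_ab N q
  rw [hco.gcd_eq_one] at hbez
  have : x q = Nat.gcdA N q • (N • x q) + Nat.gcdB N q • ((q : ℕ) • x q) := by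
    rw [← natCast_zsmul (x q) N, ← natCast_zsmul (x q) q, ← mul_smul, ← mul_smul, ← add_smul,
      mul_comm _ (N : ℤ), mul_comm _ ((q : ℕ) : ℤ), ← hbez]
    simp
  rw [this, hx q hq, smul_zero, add_zero]
  exact H.zsmul_mem hNq _

/-- An injective homomorphism extends injectively to the `p`-socle. -/
theorem exists_injective_torsionBy_extension {G : Type} [AddCommGroup G] (H : AddSubgroup G)
    {K : Type} [AddCommGroup K] {p : ℕ} (hprime : p.Prime) (hH : pRank p H < pRank p K)
    (hG : pRank p G ≤ pRank p K) (j : H →+ K) (hj : Function.Injective j) :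
    ∃ φ : AddSubgroup.torsionBy G p →+ K, Function.Injective φ ∧
      ∀ (x : AddSubgroup.torsionBy G p) (hx : (x : G) ∈ H), φ x = j ⟨x, hx⟩ := by
  have := Fact.mk hprime
  let := AddSubgroup.torsionBy.zmodModule (A := G) (n := p)
  let := AddSubgroup.torsionBy.zmodModule (A := K) (n := p)
  let := AddSubgroup.torsionBy.zmodModule (A := H) (n := p)
  let U : Submodule (ZMod p) (AddSubgroup.torsionBy G p) :=
    AddSubgroup.toZModSubmodule p (H.addSubgroupOf (AddSubgroup.torsionBy G p))
  let i : U →+ AddSubgroup.torsionBy H p :=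
    { toFun := fun u => ⟨⟨u, u.2⟩, by
        rw [AddSubgroup.torsionBy.nsmul_iff]
        exact Subtype.ext (AddSubgroup.torsionBy.nsmul_iff.1 u.1.2)⟩
      map_zero' := rfl
      map_add' := fun _ _ => rfl }
  have hi : Function.Injective i := fun u v h => by
    have := congrArg (fun z : AddSubgroup.torsionBy H (p : ℤ) => ((z : H) : G)) h
    exact Subtype.ext (Subtype.ext this)
  let k : AddSubgroup.torsionBy H p →+ AddSubgroup.torsionBy K p :=
    (j.comp (AddSubgroup.subtype _)).codRestrict _ fun x => by
      rw [AddSubgroup.torsionBy.nsmul_iff, ← map_nsmul, AddSubgroup.torsionBy.nsmul, map_zero]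
  have hk : Function.Injective k := fun u v h => Subtype.ext (hj (congrArg Subtype.val h))
  have hU : Module.rank (ZMod p) U < Module.rank (ZMod p) (AddSubgroup.torsionBy K p) :=
    (LinearMap.rank_le_of_injective (i.toZModLinearMap p) hi).trans_lt hH
  obtain ⟨f, hf, hker⟩ := (Module.Baer.of_injective
    (Module.injective_of_isSemisimpleRing (ZMod p) (AddSubgroup.torsionBy K p))
    ).exists_extension_torsion_ker U ((k.comp i).toZModLinearMap p) (hk.comp hi) hU hG
  refine ⟨(AddSubgroup.subtype _).comp f.toAddMonoidHom, ?_, fun x hx => ?_⟩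
  · refine Subtype.val_injective.comp ((injective_iff_map_eq_zero f).2 fun x hx => ?_)
    obtain ⟨a, ha, hax⟩ := hker x hx
    exact (smul_eq_zero.1 hax).resolve_left ha
  · exact congrArg Subtype.val (hf ⟨x, hx⟩)

/-- A homomorphism that is injective on all `p`-socles has torsion-free kernel. -/
theorem AddMonoidHom.eq_zero_of_injective_on_socles {G K : Type} [AddCommGroup G]
    [AddCommGroup K] (f : G →+ K)
    (hf : ∀ p : ℕ, p.Prime → ∀ x : G, p • x = 0 → f x = 0 → x = 0)
    (n : ℕ) (hn : n ≠ 0) (x : G) (hx : n • x = 0) (hfx : f x = 0) : x = 0 := by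
  induction n using Nat.recOnMul generalizing x with
  | zero => exact absurd rfl hn
  | one => simpa using hx
  | prime p hp => exact hf p hp x hx hfx
  | mul a b iha ihb =>
    rw [mul_smul] at hx
    refine ihb (right_ne_zero_of_mul hn) x (iha (left_ne_zero_of_mul hn) _ hx ?_) hfx
    rw [map_nsmul, hfx, smul_zero]

/-- An injective homomorphism into a Baer module extends to a homomorphism that is injective
on all `p`-socles. -/
theorem exists_extension_injective_on_socles {G : Type} [AddCommGroup G] (H : AddSubgroup G)
    {K : Type} [AddCommGroup K] (hK : Module.Baer ℤ K)
    (hp : ∀ p : ℕ, p.Prime → pRank p H < pRank p K)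
    (hp' : ∀ p : ℕ, p.Prime → pRank p G ≤ pRank p K)
    (j : H →+ K) (hj : Function.Injective j) :
    ∃ f : G →+ K, (∀ h : H, f h = j h) ∧
      ∀ p : ℕ, p.Prime → ∀ x : G, p • x = 0 → f x = 0 → x = 0 := by
  classical
  choose φ hφ hφj using fun p : Nat.Primes =>
    exists_injective_torsionBy_extension H p.2 (hp p p.2) (hp' p p.2) j hj
  let σ : (Π₀ p : Nat.Primes, AddSubgroup.torsionBy G (p : ℕ)) →+ G := DFinsupp.liftAddHom fun p => AddSubgroup.subtype _
  let τ : (Π₀ p : Nat.Primes, AddSubgroup.torsionBy G (p : ℕ)) →+ K := DFinsupp.liftAddHom φ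
  obtain ⟨f, hf⟩ := hK.exists_comp_eq (H.subtype.coprod σ).toIntLinearMap
    (j.coprod τ).toIntLinearMap (by
      rintro ⟨h, d⟩ hd
      have hd : (h : G) + σ d = 0 := hd
      change j h + τ d = 0
      have hσ : σ d = ∑ p ∈ d.support, (d p : G) := by
        simp [σ, DFinsupp.sumAddHom_apply, DFinsupp.sum]
      have hτ : τ d = ∑ p ∈ d.support, φ p (d p) := by
        simp [τ, DFinsupp.sumAddHom_apply, DFinsupp.sum]
      have hdH : ∀ p ∈ d.support, (d p : G) ∈ H :=
        H.mem_of_sum_mem_of_prime_smul_eq_zero d.support (fun p => d p)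
          (fun p _ => AddSubgroup.torsionBy.nsmul_iff.1 (d p).2)
          (by rw [← hσ, eq_neg_of_add_eq_zero_right hd]; exact H.neg_mem h.2)
      have hsum : h + ∑ p ∈ d.support.attach, (⟨d p.1, hdH p.1 p.2⟩ : H) = 0 := by
        apply Subtype.ext
        refine Eq.trans ?_ hd
        rw [hσ, ← Finset.sum_attach d.support, AddSubgroup.coe_add, AddSubgroup.val_finsetSum]
      rw [hτ, ← Finset.sum_attach, ← map_zero j, ← hsum, map_add, map_sum]
      congr 1
      exact Finset.sum_congr rfl fun p _ => hφj _ _ (hdH p.1 p.2))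
  refine ⟨f.toAddMonoidHom, fun h => by simpa using hf (h, 0), fun p hpp x hx hfx => ?_⟩
  have hxp := AddSubgroup.torsionBy.nsmul_iff.2 hx
  let d := DFinsupp.single (β := fun p : Nat.Primes => AddSubgroup.torsionBy G (p : ℕ))
    ⟨p, hpp⟩ ⟨x, hxp⟩
  have hσ : σ d = x := DFinsupp.liftAddHom_apply_single _ _ _
  have hτ : τ d = φ ⟨p, hpp⟩ ⟨x, hxp⟩ := DFinsupp.liftAddHom_apply_single _ _ _
  have hfφ : f x = φ ⟨p, hpp⟩ ⟨x, hxp⟩ := by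
    have h : f (σ d) = τ d := by simpa using hf (0, d)
    rw [hσ] at h
    exact h.trans hτ
  exact congrArg Subtype.val
    ((injective_iff_map_eq_zero _).1 (hφ ⟨p, hpp⟩) _ (hfφ.symm.trans hfx))

/-- A submodule which is torsion modulo `U` has the same rank as `U`. -/
theorem rank_comap_mkQ_torsion {R : Type} [CommRing R] [IsDomain R] {M : Type} [AddCommGroup M]
    [Module R M] (U : Submodule R M) :
    Module.rank R ((Submodule.torsion R (M ⧸ U)).comap U.mkQ) = Module.rank R U := by
  set P := (Submodule.torsion R (M ⧸ U)).comap U.mkQ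
  have hle : U ≤ P := fun x hx => by
    rw [Submodule.mem_comap, Submodule.mkQ_apply, (Submodule.Quotient.mk_eq_zero U).2 hx]
    exact zero_mem _
  have hzero : Module.rank R (P ⧸ U.submoduleOf P) = 0 := by
    refine Module.IsTorsion.rank_eq_zero fun y => ?_
    obtain ⟨⟨x, a, ha⟩, rfl⟩ := Submodule.Quotient.mk_surjective _ y
    refine ⟨a, (Submodule.Quotient.mk_eq_zero _).2 ?_⟩
    exact (Submodule.Quotient.mk_eq_zero U).1 ha
  rw [← (U.submoduleOf P).rank_quotient_add_rank, hzero, zero_add]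
  exact (Submodule.submoduleOfEquivOfLe hle).rank_eq

/-- If `H ≤ G` are abelian groups and `K` is a divisible abelian group with
`r_p(H) < r_p(K)` and `r_p(G) ≤ r_p(K)` for all `p ∈ {0} ∪ ℙ`, then every injective
homomorphism `j : H → K` extends to an injective homomorphism `j' : G → K`. -/
theorem exists_injective_extension_of_rank_lt
    (G : Type) [AddCommGroup G] (H : AddSubgroup G)
    (K : Type) [AddCommGroup K]
    (hdiv : ∀ n : ℤ, n ≠ 0 → ∀ y : K, ∃ x : K, n • x = y)
    (h0 : Module.rank ℤ ↥H < Module.rank ℤ K)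
    (h0' : Module.rank ℤ G ≤ Module.rank ℤ K)
    (hp : ∀ p : ℕ, Nat.Prime p → pRank p ↥H < pRank p K)
    (hp' : ∀ p : ℕ, Nat.Prime p → pRank p G ≤ pRank p K)
    (j : ↥H →+ K) (hj : Function.Injective j) :
    ∃ j' : G →+ K, Function.Injective j' ∧ ∀ h : ↥H, j' ↑h = j h := by
  have hK : Module.Baer ℤ K := by
    let : DivisibleBy K ℤ := AddCommGroup.divisibleByIntOfSMulTopEqTop K fun {n} hn => by
      rw [eq_top_iff]
      intro y _
      obtain ⟨x, hx⟩ := hdiv n hn y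
      exact (AddSubgroup.mem_smul_pointwise_iff_exists _ _ _).2 ⟨x, trivial, hx⟩
    exact Module.Baer.of_divisible K
  obtain ⟨f, hfj, hf⟩ := exists_extension_injective_on_socles H hK hp hp' j hj
  let U : Submodule ℤ G := H.toIntSubmodule
  let P : Submodule ℤ G := (Submodule.torsion ℤ (G ⧸ U)).comap U.mkQ
  have hfP : Function.Injective (f.toIntLinearMap ∘ₗ P.subtype) := by
    rw [injective_iff_map_eq_zero]
    rintro ⟨x, a, ha⟩ hfx
    have hfx : f x = 0 := hfx
    have hxH : (a : ℤ) • x ∈ H := (Submodule.Quotient.mk_eq_zero U).1 ha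
    have hax : (a : ℤ) • x = 0 := by
      have h : j ⟨_, hxH⟩ = 0 := by rw [← hfj, map_zsmul, hfx, smul_zero]
      exact congrArg Subtype.val ((injective_iff_map_eq_zero j).1 hj _ h)
    exact Subtype.ext (f.eq_zero_of_injective_on_socles hf _
      (Int.natAbs_ne_zero.2 (nonZeroDivisors.coe_ne_zero a)) x (natAbs_nsmul_eq_zero.2 hax) hfx)
  obtain ⟨g, hg, hker⟩ := hK.exists_extension_torsion_ker P _ hfP
    ((rank_comap_mkQ_torsion U).trans_lt h0) h0'
  refine ⟨g.toAddMonoidHom, (injective_iff_map_eq_zero g).2 fun x hx => ?_, fun h => ?_⟩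
  · obtain ⟨a, ha, hax⟩ := hker x hx
    have hxP : x ∈ P := ⟨⟨a, mem_nonZeroDivisors_of_ne_zero ha⟩, by
      change a • U.mkQ x = 0
      rw [← map_smul, hax, map_zero]⟩
    have h := (injective_iff_map_eq_zero _).1 hfP ⟨x, hxP⟩ ((hg ⟨x, hxP⟩).symm.trans hx)
    exact congrArg Subtype.val h
  · have hhP : (h : G) ∈ P := by
      rw [Submodule.mem_comap, Submodule.mkQ_apply, (Submodule.Quotient.mk_eq_zero U).2 h.2]
      exact zero_mem _
    exact (hg ⟨h, hhP⟩).trans (hfj h)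
end

section
/- A countable abelian group G is strongly unbounded if and only if r(nG) is infinite for every positive integer n, where r denotes the rank r(A) = max{r_0(A), Σ_p r_p(A)}. -/
/-- The subgroup `nG = {n • g : g ∈ G}` of an abelian group `G`. -/
def nsmulRange (n : ℕ) (G : Type) [AddCommGroup G] : AddSubgroup G :=
  (n • AddMonoidHom.id G).range

/-- The rank `r(G) = max{r₀(G), Σ_p r_p(G)}` of an abelian group `G`. -/
noncomputable def rankTot (G : Type) [AddCommGroup G] : Cardinal :=
  max (Module.rank ℤ G) (Cardinal.sum fun p : Nat.Primes => pRank (p : ℕ) G)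

/-- The divisible rank `r_d(G) = min{r(nG) : n ≥ 1}` of an abelian group `G`. -/
noncomputable def divisibleRank (G : Type) [AddCommGroup G] : Cardinal :=
  ⨅ n : ℕ+, rankTot ↥(nsmulRange (n : ℕ) G)

/-- Grouping an independent sequence whose `k`-th term is not killed by `k !` yields
infinitely many independent unbounded subgroups. -/
lemma exists_iSupIndep_unbounded {G : Type*} [AddCommGroup G] {x : ℕ → G}
    (hind : iSupIndep fun k => Submodule.span ℤ {x k})
    (hx : ∀ k, k.factorial • x k ≠ 0) :
    ∃ A : ℕ → AddSubgroup G, iSupIndep A ∧ ∀ i, ∀ n : ℕ, 0 < n → ∃ a ∈ A i, n • a ≠ 0 := by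
  let B : ℕ → Submodule ℤ G := fun i => ⨆ k ∈ {k : ℕ | k.unpair.1 = i}, Submodule.span ℤ {x k}
  have hle : ∀ {i k : ℕ}, k.unpair.1 = i → Submodule.span ℤ {x k} ≤ B i := fun {i k} hk =>
    le_biSup (fun k => Submodule.span ℤ {x k}) (show k ∈ {k : ℕ | k.unpair.1 = i} from hk)
  have hB : iSupIndep B := by
    intro i
    have hdis : Disjoint {k : ℕ | k.unpair.1 = i} {k : ℕ | k.unpair.1 ≠ i} :=
      Set.disjoint_left.2 fun k hk hk' => absurd hk hk'
    refine (hind.disjoint_biSup_biSup hdis).mono_right ?_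
    refine iSup₂_le fun j hj => iSup₂_le fun k hk => ?_
    have hki : k ∈ {k : ℕ | k.unpair.1 ≠ i} := fun h => hj (Eq.trans (Eq.symm hk) h)
    exact le_biSup (fun k => Submodule.span ℤ {x k}) hki
  refine ⟨fun i => AddSubgroup.toIntSubmodule.symm (B i),
    hB.map_orderIso AddSubgroup.toIntSubmodule.symm, fun i n hn => ?_⟩
  refine ⟨x (Nat.pair i n), ?_, fun h => hx (Nat.pair i n) ?_⟩
  · exact hle (by simp) (Submodule.mem_span_singleton_self _)
  · obtain ⟨c, hc⟩ := Nat.dvd_factorial hn (Nat.right_le_pair i n)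
    rw [hc, mul_comm, mul_nsmul', h, nsmul_zero]

/-- In a modular lattice, a sequence is independent if each term is disjoint from the terms of
an increasing sequence of bounds on the previous ones. -/
lemma iSupIndep_of_disjoint_bounds {α : Type*} [CompleteLattice α] [IsModularLattice α]
    [IsCompactlyGenerated α] {f F : ℕ → α} (hF : Monotone F) (hf : ∀ n, f n ≤ F (n + 1))
    (h : ∀ n, Disjoint (f n) (F n)) : iSupIndep f := by
  rw [iSupIndep_iff_supIndep]
  have hrange : ∀ n, (Finset.range n).SupIndep f := by
    intro n
    induction n with
    | zero => simp
    | succ n ih =>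
      rw [Finset.range_add_one]
      refine ih.insert ((h n).mono_right (Finset.sup_le fun k hk => ?_))
      exact (hf k).trans (hF (Finset.mem_range.1 hk))
  intro s
  obtain ⟨n, hn⟩ := s.exists_nat_subset_range
  exact (hrange n).subset hn

/-- A nonzero element of `nG` of prime order outside a finite subgroup `F` can be divided to an
element of finite order, not killed by `n`, whose multiples avoid `F`. -/
lemma exists_disjoint_span_singleton {G : Type*} [AddCommGroup G] (F : Submodule ℤ G)
    {n p : ℕ} (hn : 0 < n) (hp : p.Prime) {w : G} (hpw : p • n • w = 0) (hw : n • w ∉ F) :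
    ∃ y : G, IsOfFinAddOrder y ∧ n • y ≠ 0 ∧ Disjoint (Submodule.span ℤ {y}) F := by
  have hfin : IsOfFinAddOrder w :=
    isOfFinAddOrder_iff_nsmul_eq_zero.2 ⟨p * n, Nat.mul_pos hp.pos hn, by rwa [mul_nsmul']⟩
  obtain ⟨e, m, hpm, hem⟩ := Nat.exists_eq_pow_mul_and_not_dvd hfin.addOrderOf_pos.ne' p hp.ne_one
  have hey : p ^ e • m • w = 0 := by rw [← mul_nsmul', ← hem, addOrderOf_nsmul_eq_zero]
  have hnF : n • m • w ∉ F := by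
    intro hF
    have hcop : IsCoprime (p : ℤ) (m : ℤ) :=
      Nat.isCoprime_iff_coprime.2 ((Nat.Prime.coprime_iff_not_dvd hp).2 hpm)
    obtain ⟨a, b, hab⟩ := hcop
    apply hw
    have key : n • w = b • n • m • w := by
      have h1 : n • w = (a * p + b * m : ℤ) • n • w := by rw [hab, one_zsmul]
      rw [h1, add_zsmul, mul_zsmul, mul_zsmul, natCast_zsmul, hpw, zsmul_zero, zero_add,
        natCast_zsmul, nsmul_left_comm]
    rw [key]
    exact F.smul_mem b hF
  refine ⟨m • w, hfin.nsmul, fun h => hnF (h ▸ F.zero_mem), ?_⟩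
  generalize hy : m • w = y at *
  have hpny : p • n • y = 0 := by
    rw [← hy, smul_comm n m w, smul_comm p m, hpw, smul_zero]
  rw [Submodule.disjoint_def]
  intro u hu huF
  obtain ⟨k, rfl⟩ := Submodule.mem_span_singleton.1 hu
  by_contra hku
  obtain ⟨b, -, hb⟩ := (Nat.dvd_prime_pow hp).1 (addOrderOf_dvd_of_nsmul_eq_zero hey)
  have hd : (Int.gcd k (addOrderOf y)) • y ∈ F := by
    rw [← natCast_zsmul, Int.gcd_eq_gcd_ab, add_zsmul, mul_comm k, mul_zsmul, mul_comm _
      (Int.gcdB _ _), mul_zsmul, natCast_zsmul, addOrderOf_nsmul_eq_zero, zsmul_zero, add_zero]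
    exact F.smul_mem _ huF
  have hdvd : Int.gcd k (addOrderOf y) ∣ p ^ b := by
    have := Int.gcd_dvd_right k (addOrderOf y)
    rw [← hb]
    exact_mod_cast this
  obtain ⟨c, hcb, hc⟩ := (Nat.dvd_prime_pow hp).1 hdvd
  have hcb' : c < b := by
    refine lt_of_le_of_ne hcb ?_
    rintro rfl
    apply hku
    rw [← addOrderOf_dvd_iff_zsmul_eq_zero, hb, ← hc]
    exact Int.gcd_dvd_left k _
  have hcn : p ^ c ∣ n := by
    have h1 : p ^ (c + 1) ∣ p * n :=
      (pow_dvd_pow p hcb').trans (hb ▸ addOrderOf_dvd_of_nsmul_eq_zero (by rwa [mul_nsmul']))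
    rw [pow_succ', Nat.mul_dvd_mul_iff_left hp.pos] at h1
    exact h1
  obtain ⟨t, rfl⟩ := hcn
  apply hnF
  rw [mul_comm, mul_nsmul', ← hc]
  exact F.smul_of_tower_mem t hd

/-- If the total `p`-rank is infinite, elements of prime order escape every finite set. -/
lemma exists_prime_order_notMem {H : Type} [AddCommGroup H]
    (h : Cardinal.aleph0 ≤ Cardinal.sum fun p : Nat.Primes => pRank (p : ℕ) H)
    {F : Set H} (hF : F.Finite) : ∃ p : ℕ, p.Prime ∧ ∃ z : H, p • z = 0 ∧ z ∉ F := by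
  by_contra! hcon
  have hbasis : ∀ p : Nat.Primes, ∃ s : Set (AddSubgroup.torsionBy H ((p : ℕ) : ℤ)),
      Cardinal.mk s = pRank (p : ℕ) H ∧ (0 : AddSubgroup.torsionBy H ((p : ℕ) : ℤ)) ∉ s := by
    intro p
    have : Fact (p : ℕ).Prime := ⟨p.2⟩
    let _ := AddSubgroup.torsionBy.zmodModule (A := H) (n := (p : ℕ))
    obtain ⟨s, hs, hli⟩ := exists_set_linearIndependent (ZMod p)
      (AddSubgroup.torsionBy H ((p : ℕ) : ℤ))
    exact ⟨s, hs, fun h0 => hli.ne_zero ⟨0, h0⟩ rfl⟩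
  choose s hs hs0 using hbasis
  have hmk : (Cardinal.sum fun p : Nat.Primes => pRank (p : ℕ) H)
      = Cardinal.mk (Σ p : Nat.Primes, s p) := by
    rw [Cardinal.mk_sigma]
    simp only [hs]
  have hfin : Finite (Σ p : Nat.Primes, s p) := by
    have := hF.to_subtype
    have htor : ∀ (p : Nat.Primes) (a : s p), (p : ℕ) • (a.1 : H) = 0 := fun p a =>
      AddSubgroup.torsionBy.nsmul_iff.1 a.1.2
    refine Finite.of_injective (β := F)
      (fun a => ⟨(a.2.1 : H), hcon a.1 a.1.2 _ (htor _ _)⟩) ?_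
    rintro ⟨p, a⟩ ⟨q, b⟩ hab
    have hab' : (a.1 : H) = (b.1 : H) := congrArg Subtype.val hab
    have hane : (a.1 : H) ≠ 0 := fun h0 => hs0 p (by
      have : a.1 = 0 := Subtype.ext h0
      exact this ▸ a.2)
    have hpq : p = q := by
      have : Fact (p : ℕ).Prime := ⟨p.2⟩
      have : Fact (q : ℕ).Prime := ⟨q.2⟩
      have h1 := addOrderOf_eq_prime (htor p a) hane
      have h2 := addOrderOf_eq_prime (htor q b) (hab' ▸ hane)
      exact Subtype.ext (h1.symm.trans ((congrArg addOrderOf hab').trans h2))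
    subst hpq
    rw [show a = b from Subtype.ext (Subtype.ext hab')]
  rw [hmk] at h
  exact absurd (Cardinal.lt_aleph0_of_finite (Σ p : Nat.Primes, s p)) h.not_gt

/-- An infinite family of nonzero elements satisfying only trivial relations forces the rank to
be infinite. -/
lemma aleph0_le_rankTot {H : Type} [AddCommGroup H] {ι : Type} [Infinite ι] {x : ι → H}
    (hx : ∀ i, x i ≠ 0)
    (hind : ∀ (s : Finset ι) (c : ι → ℤ), ∑ i ∈ s, c i • x i = 0 → ∀ i ∈ s, c i • x i = 0) :
    Cardinal.aleph0 ≤ rankTot H := by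
  classical
  by_cases hinf : Infinite {i // ¬ IsOfFinAddOrder (x i)}
  · refine le_max_of_le_left ((Cardinal.aleph0_le_mk {i // ¬ IsOfFinAddOrder (x i)}).trans ?_)
    refine LinearIndependent.cardinal_le_rank (v := fun i : {i // ¬ IsOfFinAddOrder (x i)} =>
      x i) ?_
    rw [linearIndependent_iff']
    intro s g hg i hi
    have := hind (s.map (Function.Embedding.subtype _))
      (fun j => if hj : ¬ IsOfFinAddOrder (x j) then g ⟨j, hj⟩ else 0) (by
        rw [Finset.sum_map, ← hg]
        refine Finset.sum_congr rfl fun j _ => ?_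
        simp [j.2]) i (Finset.mem_map_of_mem _ hi)
    rw [dif_pos i.2] at this
    by_contra h0
    exact i.2 (isOfFinAddOrder_iff_zsmul_eq_zero.2 ⟨g i, h0, this⟩)
  · have hT : Infinite {i // IsOfFinAddOrder (x i)} := by
      by_contra hT
      rw [not_infinite_iff_finite] at hT hinf
      have : Finite ι := Finite.of_equiv _ (Equiv.sumCompl fun i => IsOfFinAddOrder (x i))
      exact not_finite ι
    have hprime : ∀ i : {i // IsOfFinAddOrder (x i)}, ∃ (p : Nat.Primes) (k : ℕ),
        k • x i ≠ 0 ∧ (p : ℕ) • k • x i = 0 := by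
      intro i
      have h1 : addOrderOf (x i) ≠ 1 := fun h => hx i (AddMonoid.addOrderOf_eq_one_iff.1 h)
      obtain ⟨p, hp, k, hk⟩ := Nat.exists_prime_and_dvd h1
      refine ⟨⟨p, hp⟩, k, fun h0 => ?_, ?_⟩
      · have hpos := i.2.addOrderOf_pos
        have hkpos : 0 < k := Nat.pos_of_ne_zero (by rintro rfl; simp [hk] at hpos)
        have hle := Nat.le_of_dvd hkpos (addOrderOf_dvd_of_nsmul_eq_zero h0)
        rw [hk] at hle
        nlinarith [hp.two_le]
      · rw [← mul_nsmul', ← hk, addOrderOf_nsmul_eq_zero]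
    choose p k hk0 hpk using hprime
    refine le_max_of_le_right ?_
    calc Cardinal.aleph0 ≤ Cardinal.mk {i // IsOfFinAddOrder (x i)} := Cardinal.aleph0_le_mk _
      _ = Cardinal.mk (Σ q : Nat.Primes, {i // p i = q}) :=
          Cardinal.mk_congr (Equiv.sigmaFiberEquiv p).symm
      _ = Cardinal.sum fun q : Nat.Primes => Cardinal.mk {i // p i = q} := Cardinal.mk_sigma _
      _ ≤ _ := Cardinal.sum_le_sum _ _ fun q => ?_
    have : Fact (q : ℕ).Prime := ⟨q.2⟩
    let _ := AddSubgroup.torsionBy.zmodModule (A := H) (n := (q : ℕ))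
    let v : {i // p i = q} → AddSubgroup.torsionBy H ((q : ℕ) : ℤ) := fun i =>
      ⟨k i • x i, AddSubgroup.torsionBy.nsmul_iff.2 (by simpa only [i.2] using hpk i)⟩
    refine LinearIndependent.cardinal_le_rank (R := ZMod q) (v := v) ?_
    rw [linearIndependent_iff']
    intro s g hg i hi
    have hcoe : ∀ j, ((g j • v j : AddSubgroup.torsionBy H ((q : ℕ) : ℤ)) : H)
        = (((g j).val * k j : ℕ) : ℤ) • x j := by
      intro j
      conv_lhs => rw [← ZMod.natCast_zmod_val (g j), Nat.cast_smul_eq_nsmul]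
      rw [natCast_zsmul, mul_nsmul']
      rfl
    have hg' := congrArg (Subtype.val : AddSubgroup.torsionBy H ((q : ℕ) : ℤ) → H) hg
    have := hind (s.map ((Function.Embedding.subtype _).trans (Function.Embedding.subtype _)))
      (fun j => if hj : ∃ h : IsOfFinAddOrder (x j), p ⟨j, h⟩ = q then
        (((g ⟨⟨j, hj.1⟩, hj.2⟩).val * k ⟨j, hj.1⟩ : ℕ) : ℤ) else 0) (by
        rw [Finset.sum_map]
        refine Eq.trans ?_ hg'
        rw [AddSubgroup.val_finsetSum]
        refine Finset.sum_congr rfl fun j _ => ?_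
        rw [hcoe, dif_pos ⟨j.1.2, j.2⟩]
        rfl) i.1.1 (Finset.mem_map_of_mem _ hi)
    rw [dif_pos ⟨i.1.2, i.2⟩] at this
    have hz : g i • v i = 0 := Subtype.ext ((hcoe i).trans this)
    exact (smul_eq_zero.1 hz).resolve_right fun h0 => hk0 i (congrArg Subtype.val h0)

/-- The elements of `nG` are the multiples `n • g`. -/
lemma mem_nsmulRange {n : ℕ} {G : Type} [AddCommGroup G] {x : G} :
    x ∈ nsmulRange n G ↔ ∃ g, n • g = x := by
  simp [nsmulRange, AddMonoidHom.mem_range]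

/-- If `G` contains infinitely many independent subgroups not killed by `n`, then `nG` has
infinite rank. -/
lemma aleph0_le_rankTot_nsmulRange {G I : Type} [AddCommGroup G] [Infinite I]
    {A : I → AddSubgroup G} (hA : iSupIndep A) {n : ℕ} (h : ∀ i, ∃ a ∈ A i, n • a ≠ 0) :
    Cardinal.aleph0 ≤ rankTot ↥(nsmulRange n G) := by
  choose a haA ha using h
  refine aleph0_le_rankTot (x := fun i => (⟨n • a i, mem_nsmulRange.2 ⟨a i, rfl⟩⟩ :
    nsmulRange n G)) (fun i h0 => ha i (congrArg Subtype.val h0)) fun s c hc i hi => ?_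
  have hA' := (iSupIndep_iff_finsetSum_eq_zero_imp_eq_zero _).1
    (hA.map_orderIso AddSubgroup.toIntSubmodule)
  refine Subtype.ext (hA' s (fun i => c i • n • a i) (fun j _ => ?_) ?_ i hi)
  · exact (A j).zsmul_mem ((A j).nsmul_mem (haA j) n) (c j)
  · have := congrArg (Subtype.val : nsmulRange n G → G) hc
    rwa [AddSubgroup.val_finsetSum] at this

/-- If the total `p`-rank of every `nG` is infinite, there is an independent sequence whose
`k`-th term is not killed by `k !`. -/
lemma exists_independent_seq_of_torsion {G : Type} [AddCommGroup G]
    (h : ∀ n : ℕ, 0 < n → Cardinal.aleph0 ≤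
      Cardinal.sum fun p : Nat.Primes => pRank (p : ℕ) ↥(nsmulRange n G)) :
    ∃ x : ℕ → G, (iSupIndep fun k => Submodule.span ℤ {x k}) ∧
      ∀ k, k.factorial • x k ≠ 0 := by
  have hstep : ∀ (k : ℕ) (F : {F : Submodule ℤ G // Finite F}), ∃ y : G, IsOfFinAddOrder y ∧
      k.factorial • y ≠ 0 ∧ Disjoint (Submodule.span ℤ {y}) F.1 := by
    rintro k ⟨F, hF⟩
    obtain ⟨p, hp, ⟨z, hz⟩, hpz, hzF⟩ := exists_prime_order_notMem (h _ k.factorial_pos)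
      (F := Subtype.val ⁻¹' (F : Set G))
      (Set.Finite.preimage Subtype.val_injective.injOn (Set.toFinite _))
    obtain ⟨w, rfl⟩ := mem_nsmulRange.1 hz
    exact exists_disjoint_span_singleton F k.factorial_pos hp (congrArg Subtype.val hpz) hzF
  choose y hyfin hy0 hydis using hstep
  have hfin : ∀ k F, Finite ↥(F.1 ⊔ Submodule.span ℤ {y k F}) := by
    intro k F
    have := F.2
    have : Finite ↥(Submodule.span ℤ {y k F}) := by
      have := (hyfin k F).finite_zmultiples
      rw [← Submodule.span_singleton_toAddSubgroup_eq_zmultiples] at this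
      exact this.to_subtype
    have : ((F.1 ⊔ Submodule.span ℤ {y k F} : Submodule ℤ G) : Set G).Finite := by
      rw [Submodule.coe_sup]
      exact (Set.toFinite _).add (Set.toFinite _)
    exact this.to_subtype
  let F : ℕ → {F : Submodule ℤ G // Finite F} := fun k =>
    Nat.rec ⟨⊥, inferInstance⟩ (fun k F => ⟨F.1 ⊔ Submodule.span ℤ {y k F}, hfin k F⟩) k
  refine ⟨fun k => y k (F k), iSupIndep_of_disjoint_bounds (F := fun k => (F k).1)
    (monotone_nat_of_le_succ fun k => le_sup_left) (fun k => le_sup_right)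
    fun k => hydis k (F k), fun k => hy0 k (F k)⟩

/-- If the free rank is infinite, there is an independent sequence whose `k`-th term is not
killed by `k !`. -/
lemma exists_independent_seq_of_rank {G : Type} [AddCommGroup G]
    (h : Cardinal.aleph0 ≤ Module.rank ℤ G) :
    ∃ x : ℕ → G, (iSupIndep fun k => Submodule.span ℤ {x k}) ∧
      ∀ k, k.factorial • x k ≠ 0 := by
  obtain ⟨s, hs, hli⟩ := exists_set_linearIndependent_of_isDomain ℤ G
  have : Infinite s := Cardinal.infinite_iff.2 (hs ▸ h)
  have hli' :=
    LinearIndependent.comp hli (Infinite.natEmbedding s) (Infinite.natEmbedding s).injective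
  refine ⟨_, hli'.iSupIndep_span_singleton, fun k h0 => k.factorial_ne_zero ?_⟩
  have := linearIndependent_iff'.1 hli' {k} (fun _ => (k.factorial : ℤ))
    (by simpa [natCast_zsmul] using h0) k (by simp)
  exact_mod_cast this

/-- A group of infinite exponent is infinite. -/
lemma infinite_of_unbounded {G : Type*} [AddCommGroup G]
    (h : ∀ n : ℕ, 0 < n → ∃ a : G, n • a ≠ 0) : Infinite G := by
  by_contra hfin
  rw [not_infinite_iff_finite] at hfin
  obtain ⟨a, ha⟩ := h (Nat.card G) Nat.card_pos
  exact ha card_nsmul_eq_zero'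

/-- A countable abelian group `G` is strongly unbounded if and only if `r(nG)` is infinite
for every positive integer `n`. -/
theorem countable_stronglyUnbounded_iff (G : Type) [AddCommGroup G] [Countable G] :
    (∃ (I : Type) (A : I → AddSubgroup G), Cardinal.mk I = Cardinal.mk G ∧
        iSupIndep A ∧ ∀ i, ∀ n : ℕ, 0 < n → ∃ a ∈ A i, n • a ≠ 0) ↔
      ∀ n : ℕ, 0 < n → Cardinal.aleph0 ≤ rankTot ↥(nsmulRange n G) := by
  constructor
  · rintro ⟨I, A, hI, hA, hun⟩ n hn
    have hne : Nonempty I := by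
      rw [← Cardinal.mk_ne_zero_iff, hI, Cardinal.mk_ne_zero_iff]
      exact ⟨0⟩
    have : Infinite G := infinite_of_unbounded fun n hn =>
      (hun hne.some n hn).imp fun _ ha => ha.2
    have : Infinite I := by
      rw [Cardinal.infinite_iff, hI]
      exact Cardinal.aleph0_le_mk G
    exact aleph0_le_rankTot_nsmulRange hA fun i => hun i n hn
  · intro h
    have hseq : ∃ x : ℕ → G, (iSupIndep fun k => Submodule.span ℤ {x k}) ∧
        ∀ k, k.factorial • x k ≠ 0 := by
      by_cases hr : Cardinal.aleph0 ≤ Module.rank ℤ G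
      · exact exists_independent_seq_of_rank hr
      · refine exists_independent_seq_of_torsion fun n hn => ?_
        refine (le_max_iff.1 (h n hn)).resolve_left fun hle => hr (hle.trans ?_)
        exact LinearMap.rank_le_of_injective (nsmulRange n G).subtype.toIntLinearMap
          Subtype.val_injective
    obtain ⟨x, hind, hx⟩ := hseq
    obtain ⟨A, hA, hun⟩ := exists_iSupIndep_unbounded hind hx
    have : Infinite G := infinite_of_unbounded fun n hn => (hun 0 n hn).imp fun _ ha => ha.2
    exact ⟨ℕ, A, by simp, hA, hun⟩
end
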